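/- A normal holomorphic motion 𝒢 is continuous if and only if it is strongly unbranched. -/

import Mathlib

open Filter Metric Set

/-- A family of graphs `γ : 𝔻 → ℂ²` is normal if every sequence has a subsequence
either converging locally uniformly on `𝔻` to a holomorphic map, or tending to infinity
uniformly on compact subsets of `𝔻`. -/
def IsNormalGraphFamily (G : Set (ℂ → ℂ × ℂ)) : Prop :=
  ∀ g : ℕ → ℂ → ℂ × ℂ, (∀ n, g n ∈ G) →
    ∃ φ : ℕ → ℕ, StrictMono φ ∧
      ((∃ γ : ℂ → ℂ × ℂ, DifferentiableOn ℂ γ (Metric.ball 0 1) ∧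
          TendstoLocallyUniformlyOn (fun j => g (φ j)) γ atTop (Metric.ball 0 1)) ∨
        (∀ K, K ⊆ Metric.ball (0 : ℂ) 1 → IsCompact K → ∀ C : ℝ,
          ∀ᶠ j in atTop, ∀ z ∈ K, C ≤ ‖g (φ j) z‖))

/-- The closure `𝒢̄` of a family of graphs: all holomorphic maps on `𝔻` that are locally
uniform limits of sequences in `𝒢`. -/
def GraphClosure (G : Set (ℂ → ℂ × ℂ)) : Set (ℂ → ℂ × ℂ) :=
  {γ | DifferentiableOn ℂ γ (Metric.ball 0 1) ∧
    ∃ g : ℕ → ℂ → ℂ × ℂ, (∀ n, g n ∈ G) ∧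
      TendstoLocallyUniformlyOn g γ atTop (Metric.ball 0 1)}

/-- `𝒢` is a holomorphic motion: the graphs of distinct elements are pairwise disjoint
over `𝔻`. -/
def IsHoloMotion (G : Set (ℂ → ℂ × ℂ)) : Prop :=
  ∀ γ ∈ G, ∀ γ' ∈ G, ¬ Set.EqOn γ γ' (Metric.ball 0 1) →
    ∀ lam ∈ Metric.ball (0 : ℂ) 1, γ lam ≠ γ' lam

/-- A holomorphic motion `𝒢` is continuous: every `h_λ : 𝒢_0 → 𝒢_λ`, `γ(0) ↦ γ(λ)`,
is a homeomorphism. -/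
def IsContinuousMotion (G : Set (ℂ → ℂ × ℂ)) : Prop :=
  ∃ h h' : ℂ → ℂ × ℂ → ℂ × ℂ,
    (∀ lam ∈ Metric.ball (0 : ℂ) 1, ∀ γ ∈ G,
      h lam (γ 0) = γ lam ∧ h' lam (γ lam) = γ 0) ∧
    (∀ lam ∈ Metric.ball (0 : ℂ) 1,
      ContinuousOn (h lam) ((fun γ => γ 0) '' G)) ∧
    (∀ lam ∈ Metric.ball (0 : ℂ) 1,
      ContinuousOn (h' lam) ((fun γ => γ lam) '' G))

/-- `𝒢` is strongly unbranched: no graph of `𝒢` meets any other graph of the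
closure `𝒢̄`. -/
def IsStronglyUnbranched (G : Set (ℂ → ℂ × ℂ)) : Prop :=
  ∀ γ ∈ G, ∀ γ' ∈ GraphClosure G, ¬ Set.EqOn γ γ' (Metric.ball 0 1) →
    ∀ lam ∈ Metric.ball (0 : ℂ) 1, γ lam ≠ γ' lam

/-- The value at `b` of a graph of `G` whose value at `a` is `p` (and `0` if there is none). -/
noncomputable def graphTransport (G : Set (ℂ → ℂ × ℂ)) (a b : ℂ) (p : ℂ × ℂ) : ℂ × ℂ :=
  open Classical in if h : ∃ γ ∈ G, γ a = p then h.choose b else 0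

theorem IsHoloMotion.graphTransport_apply {G : Set (ℂ → ℂ × ℂ)} (hG : IsHoloMotion G) {a b : ℂ}
    (ha : a ∈ ball (0 : ℂ) 1) (hb : b ∈ ball (0 : ℂ) 1) {γ : ℂ → ℂ × ℂ} (hγ : γ ∈ G) :
    graphTransport G a b (γ a) = γ b := by
  have h : ∃ γ' ∈ G, γ' a = γ a := ⟨γ, hγ, rfl⟩
  rw [graphTransport, dif_pos h]
  obtain ⟨hmem, heq⟩ := h.choose_spec
  by_contra hne
  exact hG _ hmem _ hγ (fun hEq => hne (hEq hb)) a ha heq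

theorem IsNormalGraphFamily.continuousOn_graphTransport {G : Set (ℂ → ℂ × ℂ)}
    (hnormal : IsNormalGraphFamily G) (hmotion : IsHoloMotion G) (hub : IsStronglyUnbranched G)
    {a b : ℂ} (ha : a ∈ ball (0 : ℂ) 1) (hb : b ∈ ball (0 : ℂ) 1) :
    ContinuousOn (graphTransport G a b) ((fun γ => γ a) '' G) := by
  rintro _ ⟨γ, hγ, rfl⟩
  refine tendsto_of_subseq_tendsto fun p hp => ?_
  obtain ⟨hpγ, hpG⟩ := tendsto_nhdsWithin_iff.1 hp
  obtain ⟨N, hN⟩ := eventually_atTop.1 hpG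
  choose g hgG hgp using fun n => hN (n + N) (Nat.le_add_left N n)
  have hga : Tendsto (fun n => g n a) atTop (nhds (γ a)) := by
    simpa only [hgp] using (tendsto_add_atTop_iff_nat N).2 hpγ
  obtain ⟨φ, hφ, ⟨γ', hγ', hlim⟩ | hinf⟩ := hnormal g hgG
  · have heq : γ' a = γ a :=
      tendsto_nhds_unique (hlim.tendsto_at ha) (hga.comp hφ.tendsto_atTop)
    have hEq : EqOn γ γ' (ball 0 1) := by
      by_contra hne
      exact hub γ hγ γ' ⟨hγ', _, fun n => hgG (φ n), hlim⟩ hne a ha heq.symm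
    refine ⟨fun n => φ n + N, ?_⟩
    simp only [← hgp, hmotion.graphTransport_apply ha hb (hgG _),
      hmotion.graphTransport_apply ha hb hγ, hEq hb]
    exact hlim.tendsto_at hb
  · have hbdd := (hga.comp hφ.tendsto_atTop).norm.eventually_lt_const
      (lt_add_one ‖γ a‖)
    have hlarge := hinf {a} (singleton_subset_iff.2 ha) isCompact_singleton (‖γ a‖ + 1)
    obtain ⟨n, hlt, hle⟩ := (hbdd.and hlarge).exists
    exact absurd (hle a rfl) hlt.not_ge

theorem IsContinuousMotion.isStronglyUnbranched {G : Set (ℂ → ℂ × ℂ)}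
    (hG : IsContinuousMotion G) : IsStronglyUnbranched G := by
  obtain ⟨h, h', hval, hcont, hcont'⟩ := hG
  rintro γ hγ γ' ⟨-, g, hgG, hlim⟩ hne a ha heq
  refine hne fun b hb => ?_
  have hga : Tendsto (fun n => g n a) atTop (nhds (γ a)) := heq ▸ hlim.tendsto_at ha
  have hg0 : Tendsto (fun n => g n 0) atTop (nhds (γ 0)) := by
    have := (hcont' a ha (γ a) ⟨γ, hγ, rfl⟩).tendsto.comp
      (tendsto_nhdsWithin_iff.2 ⟨hga, .of_forall fun n => ⟨g n, hgG n, rfl⟩⟩)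
    simpa only [Function.comp_def, (hval a ha _ (hgG _)).2, (hval a ha γ hγ).2] using this
  have hgb : Tendsto (fun n => g n b) atTop (nhds (γ b)) := by
    have := (hcont b hb (γ 0) ⟨γ, hγ, rfl⟩).tendsto.comp
      (tendsto_nhdsWithin_iff.2 ⟨hg0, .of_forall fun n => ⟨g n, hgG n, rfl⟩⟩)
    simpa only [Function.comp_def, (hval b hb _ (hgG _)).1, (hval b hb γ hγ).1] using this
  exact tendsto_nhds_unique hgb (hlim.tendsto_at hb)

/-- **Lemma.** A normal holomorphic motion is continuous if and only if it is strongly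
unbranched. -/
theorem continuous_iff_stronglyUnbranched
    (G : Set (ℂ → ℂ × ℂ))
    (hGhol : ∀ γ ∈ G, DifferentiableOn ℂ γ (Metric.ball 0 1))
    (hGnormal : IsNormalGraphFamily G)
    (hGmotion : IsHoloMotion G) :
    IsContinuousMotion G ↔ IsStronglyUnbranched G := by
  refine ⟨IsContinuousMotion.isStronglyUnbranched, fun hub => ?_⟩
  have h0 : (0 : ℂ) ∈ ball (0 : ℂ) 1 := mem_ball_self one_pos
  exact ⟨fun lam => graphTransport G 0 lam, fun lam => graphTransport G lam 0,
    fun lam hlam γ hγ => ⟨hGmotion.graphTransport_apply h0 hlam hγ,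
      hGmotion.graphTransport_apply hlam h0 hγ⟩,
    fun lam hlam => hGnormal.continuousOn_graphTransport hGmotion hub h0 hlam,
    fun lam hlam => hGnormal.continuousOn_graphTransport hGmotion hub hlam h0⟩
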